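/- Let P be a finite set of points in the real plane and L a finite set of lines. Then the number of incidences |{(p,l) ∈ P×L : p ∈ l}| is at most C(|P|^{2/3}|L|^{2/3} + |P| + |L|) for some absolute constant C. -/

import Mathlib

namespace ST

/-- A point of the plane. -/
abbrev Pt := ℝ × ℝ
/-- A segment, given by its left and right end. -/
abbrev Ed := Pt × Pt

noncomputable def slope (e : Ed) : ℝ := (e.2.2 - e.1.2) / (e.2.1 - e.1.1)
noncomputable def ht (e : Ed) (t : ℝ) : ℝ := e.1.2 + slope e * (t - e.1.1)

lemma ht_left (e : Ed) : ht e e.1.1 = e.1.2 := by simp [ht]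

lemma ht_right {e : Ed} (h : e.1.1 < e.2.1) : ht e e.2.1 = e.2.2 := by
  have : e.2.1 - e.1.1 ≠ 0 := by linarith
  unfold ht slope
  field_simp
  ring

lemma ht_from (e : Ed) (s t : ℝ) : ht e t = ht e s + slope e * (t - s) := by
  unfold ht; ring

/-- Two segments meet at an interior point of both. -/
def Cross (e f : Ed) : Prop :=
  ∃ t, e.1.1 < t ∧ t < e.2.1 ∧ f.1.1 < t ∧ t < f.2.1 ∧ ht e t = ht f t

structure Good (V : Finset Pt) (E : Finset Ed) : Prop where
  inj : ∀ u ∈ V, ∀ v ∈ V, u.1 = v.1 → u = v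
  left : ∀ e ∈ E, e.1 ∈ V
  right : ∀ e ∈ E, e.2 ∈ V
  lt : ∀ e ∈ E, e.1.1 < e.2.1
  avoid : ∀ e ∈ E, ∀ v ∈ V, e.1.1 < v.1 → v.1 < e.2.1 → v.2 ≠ ht e v.1

def NonCross (E : Finset Ed) : Prop := ∀ e ∈ E, ∀ f ∈ E, e ≠ f → ¬ Cross e f

lemma sign_change {E : Finset Ed} (hN : NonCross E) {f g : Ed} (hf : f ∈ E) (hg : g ∈ E)
    {s t : ℝ} (hst : s < t) (f1 : f.1.1 ≤ s) (f2 : t ≤ f.2.1) (g1 : g.1.1 ≤ s) (g2 : t ≤ g.2.1)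
    (hs : ht f s < ht g s) (ht' : ht g t < ht f t) : False := by
  have hne : f ≠ g := by rintro rfl; exact lt_irrefl _ hs
  have e1 := ht_from f s t
  have e2 := ht_from g s t
  have hsl : 0 < slope f - slope g := by
    by_contra hcon
    push Not at hcon
    nlinarith
  set r := s + (ht g s - ht f s) / (slope f - slope g) with hr
  have hmul : (slope f - slope g) * (r - s) = ht g s - ht f s := by
    rw [hr]; field_simp; ring
  have hr1 : s < r := by
    have : 0 < (ht g s - ht f s) / (slope f - slope g) := div_pos (by linarith) hsl
    linarith
  have hr2 : r < t := by nlinarith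
  refine hN f hf g hg hne ⟨r, by linarith, by linarith, by linarith, by linarith, ?_⟩
  have e3 := ht_from f s r
  have e4 := ht_from g s r
  linarith

def Sees (E : Finset Ed) (w : Pt) (e : Ed) : Prop :=
  e.1.1 < w.1 ∧ w.1 < e.2.1 ∧ ht e w.1 < w.2 ∧
    ∀ f ∈ E, f.1.1 < w.1 → w.1 < f.2.1 → ht f w.1 < w.2 → ht f w.1 ≤ ht e w.1

lemma sees_left {V : Finset Pt} {E : Finset Ed} (hG : Good V E) (hN : NonCross E)
    {e e' : Ed} (he : e ∈ E) (he' : e' ∈ E) (h1 : e'.1 = e.1) (hs : slope e < slope e')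
    (hmin : ∀ g ∈ E, g.1 = e.1 → slope e < slope g → slope e' ≤ slope g)
    (hend : e'.2.1 < e.2.1) : ∃ w ∈ V, Sees E w e := by
  classical
  have lt' := hG.lt e' he'
  have hx : e'.1.1 = e.1.1 := by rw [h1]
  have hy : e'.1.2 = e.1.2 := by rw [h1]
  have L1 := ht_left e
  have L2 := ht_left e'
  set R := V.filter (fun w => e.1.1 < w.1 ∧ w.1 ≤ e'.2.1 ∧ ht e w.1 < w.2 ∧ w.2 ≤ ht e' w.1)
    with hR
  have hne : R.Nonempty := by
    refine ⟨e'.2, ?_⟩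
    rw [hR, Finset.mem_filter]
    have r := ht_right lt'
    refine ⟨hG.right e' he', by linarith, le_refl _, ?_, by linarith⟩
    have a := ht_from e e.1.1 e'.2.1
    have b := ht_from e' e.1.1 e'.2.1
    rw [hx] at L2
    nlinarith
  obtain ⟨w, hw, hwmin⟩ := R.exists_min_image (fun w => w.1) hne
  rw [hR, Finset.mem_filter] at hw
  obtain ⟨hwV, w1, w2, w3, w4⟩ := hw
  refine ⟨w, hwV, w1, by linarith, w3, ?_⟩
  intro f hf f1 f2 f3
  by_contra hcon
  push Not at hcon
  have ltf := hG.lt f hf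
  have Lf := ht_left f
  rcases lt_trichotomy f.1.1 e.1.1 with hlt | heq | hgt
  · have hav := hG.avoid f hf e.1 (hG.left e he) hlt (by linarith)
    rcases lt_or_gt_of_ne hav with h | h
    · refine sign_change hN he' hf w1 (by linarith) (by linarith) (by linarith) (by linarith) ?_ ?_
      · rw [hx] at L2; linarith
      · linarith
    · refine sign_change hN hf he w1 (by linarith) (by linarith) (by linarith) (by linarith) ?_ ?_
      · linarith
      · linarith
  · have hfe : f.1 = e.1 := hG.inj _ (hG.left f hf) _ (hG.left e he) heq
    have hfy : f.1.2 = e.1.2 := by rw [hfe]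
    rw [heq] at Lf
    rw [hx] at L2
    have a := ht_from e e.1.1 w.1
    have b := ht_from e' e.1.1 w.1
    have c := ht_from f e.1.1 w.1
    have s1 : slope e < slope f := by
      by_contra h; push Not at h; nlinarith
    have s2 := hmin f hf hfe s1
    nlinarith
  · have hnot : f.1 ∉ R := fun h => by
      have := hwmin _ h
      linarith
    have hav := hG.avoid e he f.1 (hG.left f hf) hgt (by linarith)
    rcases lt_or_gt_of_ne hav with h | h
    · exact sign_change hN hf he f1 (by linarith) (by linarith) (by linarith) (by linarith)
        (by linarith) (by linarith)
    · have h5 : ht e' f.1.1 < f.1.2 := by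
        by_contra h6
        push Not at h6
        apply hnot
        rw [hR, Finset.mem_filter]
        exact ⟨hG.left f hf, hgt, by linarith, h, h6⟩
      exact sign_change hN he' hf f1 (by linarith) (by linarith) (by linarith) (by linarith)
        (by linarith) (by linarith)

lemma sees_right {V : Finset Pt} {E : Finset Ed} (hG : Good V E) (hN : NonCross E)
    {e e' : Ed} (he : e ∈ E) (he' : e' ∈ E) (h1 : e'.2 = e.2) (hs : slope e' < slope e)
    (hmin : ∀ g ∈ E, g.2 = e.2 → slope g < slope e → slope g ≤ slope e')
    (hend : e.1.1 < e'.1.1) : ∃ w ∈ V, Sees E w e := by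
  classical
  have lt' := hG.lt e' he'
  have hx : e'.2.1 = e.2.1 := by rw [h1]
  have hy : e'.2.2 = e.2.2 := by rw [h1]
  have L1 := ht_right (hG.lt e he)
  have L2 := ht_right lt'
  set R := V.filter (fun w => w.1 < e.2.1 ∧ e'.1.1 ≤ w.1 ∧ ht e w.1 < w.2 ∧ w.2 ≤ ht e' w.1)
    with hR
  have hne : R.Nonempty := by
    refine ⟨e'.1, ?_⟩
    rw [hR, Finset.mem_filter]
    have r := ht_left e'
    refine ⟨hG.left e' he', by linarith, le_refl _, ?_, by linarith⟩
    have a := ht_from e e.2.1 e'.1.1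
    have b := ht_from e' e.2.1 e'.1.1
    rw [hx] at L2
    nlinarith
  obtain ⟨w, hw, hwmin⟩ := R.exists_max_image (fun w => w.1) hne
  rw [hR, Finset.mem_filter] at hw
  obtain ⟨hwV, w1, w2, w3, w4⟩ := hw
  refine ⟨w, hwV, by linarith, w1, w3, ?_⟩
  intro f hf f1 f2 f3
  by_contra hcon
  push Not at hcon
  have ltf := hG.lt f hf
  have Lf := ht_right ltf
  rcases lt_trichotomy f.2.1 e.2.1 with hgt | heq | hlt
  · have hnot : f.2 ∉ R := fun h => by
      have := hwmin _ h
      linarith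
    have hav := hG.avoid e he f.2 (hG.right f hf) (by linarith) hgt
    rcases lt_or_gt_of_ne hav with h | h
    · exact sign_change hN he hf f2 (by linarith) (by linarith) (by linarith) (by linarith)
        (by linarith) (by linarith)
    · have h5 : ht e' f.2.1 < f.2.2 := by
        by_contra h6
        push Not at h6
        apply hnot
        rw [hR, Finset.mem_filter]
        exact ⟨hG.right f hf, hgt, by linarith, h, h6⟩
      exact sign_change hN hf he' f2 (by linarith) (by linarith) (by linarith) (by linarith)
        (by linarith) (by linarith)
  · have hfe : f.2 = e.2 := hG.inj _ (hG.right f hf) _ (hG.right e he) heq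
    have hfy : f.2.2 = e.2.2 := by rw [hfe]
    rw [heq] at Lf
    rw [hx] at L2
    have a := ht_from e e.2.1 w.1
    have b := ht_from e' e.2.1 w.1
    have c := ht_from f e.2.1 w.1
    have s1 : slope f < slope e := by
      by_contra h; push Not at h; nlinarith
    have s2 := hmin f hf hfe s1
    nlinarith
  · have hav := hG.avoid f hf e.2 (hG.right e he) (by linarith) hlt
    rcases lt_or_gt_of_ne hav with h | h
    · refine sign_change hN hf he' w1 (by linarith) (by linarith) (by linarith) (by linarith) ?_ ?_
      · linarith
      · rw [hx] at L2; linarith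
    · refine sign_change hN he hf w1 (by linarith) (by linarith) (by linarith) (by linarith) ?_ ?_
      · linarith
      · linarith

lemma eq_of_left {V : Finset Pt} {E : Finset Ed} (hG : Good V E) (hN : NonCross E)
    {e f : Ed} (he : e ∈ E) (hf : f ∈ E) (h1 : e.1 = f.1) (hs : slope e = slope f) : e = f := by
  by_contra hne
  have a := hG.lt e he
  have b := hG.lt f hf
  have hx : e.1.1 = f.1.1 := by rw [h1]
  obtain ⟨t, t1, t2⟩ := exists_between (lt_min a (hx ▸ b : e.1.1 < f.2.1))
  refine hN e he f hf hne ⟨t, t1, t2.trans_le (min_le_left _ _), hx ▸ t1,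
    t2.trans_le (min_le_right _ _), ?_⟩
  unfold ht
  rw [h1, hs]

lemma eq_of_right {V : Finset Pt} {E : Finset Ed} (hG : Good V E) (hN : NonCross E)
    {e f : Ed} (he : e ∈ E) (hf : f ∈ E) (h1 : e.2 = f.2) (hs : slope e = slope f) : e = f := by
  by_contra hne
  have a := hG.lt e he
  have b := hG.lt f hf
  have hx : e.2.1 = f.2.1 := by rw [h1]
  obtain ⟨t, t1, t2⟩ := exists_between (max_lt a (hx ▸ b : f.1.1 < e.2.1))
  refine hN e he f hf hne ⟨t, (le_max_left _ _).trans_lt t1, t2, (le_max_right _ _).trans_lt t1,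
    hx ▸ t2, ?_⟩
  rw [ht_from e e.2.1 t, ht_from f f.2.1 t, ht_right a, ht_right b, h1, hs]

lemma exists_sees {V : Finset Pt} {E : Finset Ed} (hG : Good V E) (hN : NonCross E)
    {e : Ed} (he : e ∈ E) (hl : ∃ g ∈ E, g.1 = e.1 ∧ slope e < slope g)
    (hr : ∃ g ∈ E, g.2 = e.2 ∧ slope g < slope e) : ∃ w ∈ V, Sees E w e := by
  classical
  have lte := hG.lt e he
  obtain ⟨a, ha, hamin⟩ := (E.filter (fun g => g.1 = e.1 ∧ slope e < slope g)).exists_min_image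
    slope (by obtain ⟨g, hg, h⟩ := hl; exact ⟨g, Finset.mem_filter.2 ⟨hg, h⟩⟩)
  obtain ⟨b, hb, hbmax⟩ := (E.filter (fun g => g.2 = e.2 ∧ slope g < slope e)).exists_max_image
    slope (by obtain ⟨g, hg, h⟩ := hr; exact ⟨g, Finset.mem_filter.2 ⟨hg, h⟩⟩)
  rw [Finset.mem_filter] at ha hb
  obtain ⟨haE, ha1, has⟩ := ha
  obtain ⟨hbE, hb1, hbs⟩ := hb
  by_cases hA : a.2.1 < e.2.1
  · exact sees_left hG hN he haE ha1 has
      (fun g hg h1 h2 => hamin g (Finset.mem_filter.2 ⟨hg, h1, h2⟩)) hA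
  by_cases hB : e.1.1 < b.1.1
  · exact sees_right hG hN he hbE hb1 hbs
      (fun g hg h1 h2 => hbmax g (Finset.mem_filter.2 ⟨hg, h1, h2⟩)) hB
  exfalso
  push Not at hA hB
  have ax : a.1.1 = e.1.1 := by rw [ha1]
  have ay : a.1.2 = e.1.2 := by rw [ha1]
  have bx : b.2.1 = e.2.1 := by rw [hb1]
  have bY : b.2.2 = e.2.2 := by rw [hb1]
  have a0 := ht_left a
  have b0 := ht_right (hG.lt b hbE)
  have e0 := ht_left e
  have e1 := ht_right lte
  rw [ax] at a0
  rw [bx] at b0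
  have p := ht_from a e.1.1 e.2.1
  have q := ht_from b e.1.1 e.2.1
  have r := ht_from e e.1.1 e.2.1
  refine sign_change hN haE hbE lte (by linarith) (by linarith) (by linarith) (by linarith) ?_ ?_
  · nlinarith
  · nlinarith

lemma planar_bound {V : Finset Pt} {E : Finset Ed} (hG : Good V E) (hN : NonCross E) :
    E.card ≤ 3 * V.card := by
  classical
  set T1 := E.filter (fun e => ∀ g ∈ E, g.1 = e.1 → slope g ≤ slope e) with hT1
  set T2 := E.filter (fun e => ∀ g ∈ E, g.2 = e.2 → slope e ≤ slope g) with hT2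
  set T3 := E.filter (fun e => ∃ w ∈ V, Sees E w e) with hT3
  have c1 : T1.card ≤ V.card := by
    refine Finset.card_le_card_of_injOn (fun e => e.1)
      (fun e h => hG.left e (Finset.mem_filter.1 h).1) ?_
    intro e h f h' hef
    have h := Finset.mem_filter.1 h
    have h' := Finset.mem_filter.1 h'
    exact eq_of_left hG hN h.1 h'.1 hef (le_antisymm (h'.2 e h.1 hef) (h.2 f h'.1 hef.symm))
  have c2 : T2.card ≤ V.card := by
    refine Finset.card_le_card_of_injOn (fun e => e.2)
      (fun e h => hG.right e (Finset.mem_filter.1 h).1) ?_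
    intro e h f h' hef
    have h := Finset.mem_filter.1 h
    have h' := Finset.mem_filter.1 h'
    exact eq_of_right hG hN h.1 h'.1 hef (le_antisymm (h.2 f h'.1 hef.symm) (h'.2 e h.1 hef))
  have c3 : T3.card ≤ V.card := by
    have hch : ∀ e : Ed, ∃ w : Pt, e ∈ T3 → w ∈ V ∧ Sees E w e := by
      intro e
      by_cases h : e ∈ T3
      · obtain ⟨w, hw⟩ := (Finset.mem_filter.1 h).2
        exact ⟨w, fun _ => hw⟩
      · exact ⟨0, fun h' => absurd h' h⟩
    choose φ hφ using hch
    refine Finset.card_le_card_of_injOn φ (fun e h => (hφ e h).1) ?_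
    intro e h f h' hef
    have he := (Finset.mem_filter.1 h).1
    have hf := (Finset.mem_filter.1 h').1
    obtain ⟨a1, a2, a3, a4⟩ := (hφ e h).2
    obtain ⟨b1, b2, b3, b4⟩ := (hφ f h').2
    rw [← hef] at b1 b2 b3 b4
    by_contra hne
    exact hN e he f hf hne ⟨_, a1, a2, b1, b2, le_antisymm (b4 e he a1 a2 a3) (a4 f hf b1 b2 b3)⟩
  have hsub : E ⊆ T1 ∪ T2 ∪ T3 := by
    intro e he
    by_contra hcon
    simp only [Finset.mem_union, not_or, hT1, hT2, hT3, Finset.mem_filter, he, true_and] at hcon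
    obtain ⟨⟨h1, h2⟩, h3⟩ := hcon
    push Not at h1 h2
    exact h3 (exists_sees hG hN he h1 h2)
  have := Finset.card_le_card hsub
  have := Finset.card_union_le (T1 ∪ T2) T3
  have := Finset.card_union_le T1 T2
  omega

open Classical in
/-- Ordered pairs of crossing edges. -/
noncomputable def crs (E : Finset Ed) : Finset (Ed × Ed) :=
  (E ×ˢ E).filter (fun x => x.1 ≠ x.2 ∧ Cross x.1 x.2)

lemma Good.mono {V : Finset Pt} {E F : Finset Ed} (hG : Good V E) (h : F ⊆ E) : Good V F :=
  ⟨hG.inj, fun e he => hG.left e (h he), fun e he => hG.right e (h he),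
    fun e he => hG.lt e (h he), fun e he => hG.avoid e (h he)⟩

lemma weak_crossing {V : Finset Pt} : ∀ (n : ℕ) (E : Finset Ed), E.card = n → Good V E →
    E.card ≤ 3 * V.card + (crs E).card := by
  classical
  intro n
  induction n with
  | zero => intro E h _; omega
  | succ n ih =>
    intro E hc hG
    by_cases hN : NonCross E
    · have := planar_bound hG hN
      omega
    · unfold NonCross at hN
      push Not at hN
      obtain ⟨e, he, f, hf, hne, hcr⟩ := hN
      have h1 := Finset.card_erase_of_mem he
      have h2 := ih (E.erase e) (by omega) (hG.mono (Finset.erase_subset _ _))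
      have h3 : (crs (E.erase e)).card < (crs E).card := by
        apply Finset.card_lt_card
        rw [Finset.ssubset_iff_of_subset]
        · refine ⟨(e, f), ?_, ?_⟩
          · simp [crs, he, hf, hne, hcr]
          · simp [crs]
        · intro x hx
          simp only [crs, Finset.mem_filter, Finset.mem_product, Finset.mem_erase] at hx ⊢
          tauto
      omega

lemma sample {V T : Finset Pt} (hT : T ⊆ V) (p : ℝ) :
    ∑ S ∈ V.powerset, (p ^ S.card * (1 - p) ^ (V \ S).card) * (if T ⊆ S then 1 else 0)
      = p ^ T.card := by
  classical
  have h := Finset.prod_add (fun _ : Pt => p) (fun i => if i ∈ T then 0 else 1 - p) V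
  have h0 : ∏ i ∈ V, (p + if i ∈ T then 0 else 1 - p) = p ^ T.card := by
    have : ∀ i ∈ V, (p + if i ∈ T then 0 else 1 - p) = if i ∈ T then p else 1 := by
      intro i _; split_ifs <;> ring
    rw [Finset.prod_congr rfl this, Finset.prod_ite_mem, Finset.inter_eq_right.2 hT,
      Finset.prod_const]
  rw [h0] at h
  rw [h]
  refine Finset.sum_congr rfl fun S hS => ?_
  rw [Finset.prod_const, mul_assoc]
  congr 1
  split_ifs with hTS
  · rw [mul_one, ← Finset.prod_const]
    refine Finset.prod_congr rfl fun i hi => ?_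
    rw [if_neg]
    intro hiT
    exact (Finset.mem_sdiff.1 hi).2 (hTS hiT)
  · rw [mul_zero]
    obtain ⟨i, hi, hiS⟩ := Finset.not_subset.1 hTS
    exact (Finset.prod_eq_zero (Finset.mem_sdiff.2 ⟨hT hi, hiS⟩) (by simp [hi])).symm

noncomputable def ends (e : Ed) : Finset Pt := {e.1, e.2}

lemma ends_card {e : Ed} (h : e.1.1 < e.2.1) : (ends e).card = 2 := by
  classical
  apply Finset.card_pair
  intro h'
  rw [h'] at h
  exact lt_irrefl _ h

lemma cross_card {V : Finset Pt} {E : Finset Ed} (hG : Good V E) {e f : Ed} (he : e ∈ E)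
    (hf : f ∈ E) (hne : e ≠ f) (hc : Cross e f) : (ends e ∪ ends f).card = 4 := by
  classical
  obtain ⟨t, t1, t2, t3, t4, t5⟩ := hc
  have lte := hG.lt e he
  have ltf := hG.lt f hf
  have key : slope e = slope f → False := by
    intro hs
    have hall : ∀ s, ht e s = ht f s := by
      intro s
      rw [ht_from e t s, ht_from f t s, hs, t5]
    have hl : e.1 = f.1 := by
      apply hG.inj _ (hG.left e he) _ (hG.left f hf)
      by_contra h
      rcases lt_or_gt_of_ne h with h | h
      · exact hG.avoid e he f.1 (hG.left f hf) h (by linarith) (by rw [hall, ht_left])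
      · exact hG.avoid f hf e.1 (hG.left e he) h (by linarith) (by rw [← hall, ht_left])
    have hr : e.2 = f.2 := by
      apply hG.inj _ (hG.right e he) _ (hG.right f hf)
      by_contra h
      rcases lt_or_gt_of_ne h with h | h
      · exact hG.avoid f hf e.2 (hG.right e he) (by linarith) h (by rw [← hall, ht_right lte])
      · exact hG.avoid e he f.2 (hG.right f hf) (by linarith) h (by rw [hall, ht_right ltf])
    exact hne (Prod.ext hl hr)
  have sl : ∀ s, s ≠ t → ht e s = ht f s → False := by
    intro s hst h
    apply key
    rw [ht_from e t s, ht_from f t s, t5] at h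
    have h2 : slope e * (s - t) = slope f * (s - t) := by linarith
    exact mul_right_cancel₀ (sub_ne_zero.2 hst) h2
  rw [Finset.card_union_of_disjoint, ends_card lte, ends_card ltf]
  rw [Finset.disjoint_left]
  intro a ha hb
  simp only [ends, Finset.mem_insert, Finset.mem_singleton] at ha hb
  rcases ha with rfl | rfl <;> rcases hb with h | h
  · apply sl e.1.1 (by linarith)
    rw [ht_left, h, ht_left]
  · have : e.1.1 = f.2.1 := by rw [h]
    linarith
  · have : e.2.1 = f.1.1 := by rw [h]
    linarith
  · apply sl e.2.1 (by linarith)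
    rw [ht_right lte, h, ht_right ltf]

lemma crossing_p {V : Finset Pt} {E : Finset Ed} (hG : Good V E) {p : ℝ} (hp0 : 0 ≤ p)
    (hp1 : p ≤ 1) : p ^ 2 * E.card ≤ 3 * (p * V.card) + p ^ 4 * (crs E).card := by
  classical
  set w : Finset Pt → ℝ := fun S => p ^ S.card * (1 - p) ^ (V \ S).card with hw
  have hw0 : ∀ S, 0 ≤ w S := fun S =>
    mul_nonneg (pow_nonneg hp0 _) (pow_nonneg (by linarith) _)
  have each : ∀ S ∈ V.powerset,
      (∑ e ∈ E, (if ends e ⊆ S then 1 else 0 : ℝ)) ≤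
        3 * (∑ v ∈ V, (if {v} ⊆ S then 1 else 0 : ℝ)) +
          ∑ x ∈ crs E, (if ends x.1 ∪ ends x.2 ⊆ S then 1 else 0 : ℝ) := by
    intro S hS
    rw [Finset.mem_powerset] at hS
    rw [Finset.sum_boole, Finset.sum_boole, Finset.sum_boole]
    set F := E.filter (fun e => ends e ⊆ S) with hF
    have hGF : Good S F := by
      have hm : ∀ e ∈ F, e ∈ E ∧ e.1 ∈ S ∧ e.2 ∈ S := by
        intro e he
        rw [hF, Finset.mem_filter] at he
        exact ⟨he.1, he.2 (by simp [ends]), he.2 (by simp [ends])⟩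
      exact ⟨fun u hu v hv => hG.inj u (hS hu) v (hS hv), fun e he => (hm e he).2.1,
        fun e he => (hm e he).2.2, fun e he => hG.lt e (hm e he).1,
        fun e he v hv => hG.avoid e (hm e he).1 v (hS hv)⟩
    have h1 := weak_crossing _ F rfl hGF
    have h2 : V.filter (fun v => {v} ⊆ S) = S := by
      ext v
      simp only [Finset.mem_filter, Finset.singleton_subset_iff]
      exact ⟨fun h => h.2, fun h => ⟨hS h, h⟩⟩
    have h3 : crs F ⊆ (crs E).filter (fun x => ends x.1 ∪ ends x.2 ⊆ S) := by
      intro x hx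
      simp only [crs, hF, Finset.mem_filter, Finset.mem_product] at hx ⊢
      exact ⟨⟨⟨hx.1.1.1, hx.1.2.1⟩, hx.2⟩, Finset.union_subset hx.1.1.2 hx.1.2.2⟩
    have h4 := Finset.card_le_card h3
    rw [h2]
    exact_mod_cast h1.trans (by omega)
  have tot : ∑ S ∈ V.powerset, w S * (∑ e ∈ E, (if ends e ⊆ S then 1 else 0 : ℝ)) ≤
      ∑ S ∈ V.powerset, w S * (3 * (∑ v ∈ V, (if {v} ⊆ S then 1 else 0 : ℝ)) +
          ∑ x ∈ crs E, (if ends x.1 ∪ ends x.2 ⊆ S then 1 else 0 : ℝ)) :=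
    Finset.sum_le_sum fun S hS => mul_le_mul_of_nonneg_left (each S hS) (hw0 S)
  have swap : ∀ {α : Type} (A : Finset α) (T : α → Finset Pt) (k : ℕ),
      (∀ a ∈ A, T a ⊆ V ∧ (T a).card = k) →
      ∑ S ∈ V.powerset, w S * (∑ a ∈ A, (if T a ⊆ S then 1 else 0 : ℝ)) = p ^ k * A.card := by
    intro α A T k h
    simp_rw [Finset.mul_sum]
    rw [Finset.sum_comm]
    rw [Finset.sum_congr rfl (fun a ha => (sample (h a ha).1 p).trans (by rw [(h a ha).2]))]
    simp [mul_comm]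
  have hends : ∀ e ∈ E, ends e ⊆ V := by
    intro e he v hv
    simp only [ends, Finset.mem_insert, Finset.mem_singleton] at hv
    rcases hv with rfl | rfl
    · exact hG.left e he
    · exact hG.right e he
  have s1 := swap E ends 2 (fun e he => ⟨hends e he, ends_card (hG.lt e he)⟩)
  have s2 := swap V (fun v => {v}) 1 (fun v hv => ⟨by simpa using hv, by simp⟩)
  have s3 := swap (crs E) (fun x => ends x.1 ∪ ends x.2) 4 (by
    intro x hx
    simp only [crs, Finset.mem_filter, Finset.mem_product] at hx
    exact ⟨Finset.union_subset (hends _ hx.1.1) (hends _ hx.1.2),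
      cross_card hG hx.1.1 hx.1.2 hx.2.1 hx.2.2⟩)
  have : ∑ S ∈ V.powerset, w S * (3 * (∑ v ∈ V, (if {v} ⊆ S then 1 else 0 : ℝ)) +
          ∑ x ∈ crs E, (if ends x.1 ∪ ends x.2 ⊆ S then 1 else 0 : ℝ)) =
      3 * (p ^ 1 * V.card) + p ^ 4 * (crs E).card := by
    rw [← s2, ← s3, Finset.mul_sum, ← Finset.sum_add_distrib]
    exact Finset.sum_congr rfl fun S _ => by ring
  rw [s1, this, pow_one] at tot
  exact tot


def On (p : Pt) (l : ℝ × ℝ) : Prop := p.2 = l.1 * p.1 + l.2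

structure Seg (P : Finset Pt) (l : ℝ × ℝ) (e : Ed) : Prop where
  left : e.1 ∈ P
  right : e.2 ∈ P
  lt : e.1.1 < e.2.1
  on1 : On e.1 l
  on2 : On e.2 l
  consec : ∀ r ∈ P, On r l → e.1.1 < r.1 → r.1 < e.2.1 → False

lemma Seg.slope {P : Finset Pt} {l : ℝ × ℝ} {e : Ed} (h : Seg P l e) : slope e = l.1 := by
  have h1 := h.on1
  have h2 := h.on2
  have h3 := h.lt
  unfold On at h1 h2
  have : e.2.1 - e.1.1 ≠ 0 := by linarith
  unfold ST.slope
  rw [h1, h2, div_eq_iff this]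
  ring

lemma Seg.ht {P : Finset Pt} {l : ℝ × ℝ} {e : Ed} (h : Seg P l e) (t : ℝ) :
    ht e t = l.1 * t + l.2 := by
  have h1 := h.on1
  unfold On at h1
  unfold ST.ht
  rw [h.slope, h1]
  ring

lemma Seg.unique_line {P : Finset Pt} {l m : ℝ × ℝ} {e : Ed} (h : Seg P l e) (h' : Seg P m e) :
    l = m := by
  have a : l.1 = m.1 := by rw [← h.slope, h'.slope]
  refine Prod.ext a ?_
  have b := h.ht 0
  rw [h'.ht 0] at b
  linarith

lemma Seg.unique_edge {P : Finset Pt} (hinj : ∀ u ∈ P, ∀ v ∈ P, u.1 = v.1 → u = v)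
    {l : ℝ × ℝ} {e f : Ed} (h : Seg P l e) (h' : Seg P l f) {t : ℝ}
    (h1 : e.1.1 < t) (h2 : t < e.2.1) (h3 : f.1.1 < t) (h4 : t < f.2.1) : e = f := by
  have a : e.1 = f.1 := by
    apply hinj _ h.left _ h'.left
    by_contra hne
    rcases lt_or_gt_of_ne hne with hl | hl
    · exact h.consec _ h'.left h'.on1 hl (by linarith)
    · exact h'.consec _ h.left h.on1 hl (by linarith)
  have b : e.2 = f.2 := by
    apply hinj _ h.right _ h'.right
    by_contra hne
    rcases lt_or_gt_of_ne hne with hl | hl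
    · exact h'.consec _ h.right h.on2 (by linarith) hl
    · exact h.consec _ h'.right h'.on2 (by linarith) hl
  exact Prod.ext a b

open Classical in
noncomputable def szE (P : Finset Pt) (M : Finset (ℝ × ℝ)) : Finset Ed :=
  (P ×ˢ P).filter (fun e => ∃ l ∈ M, Seg P l e)

lemma mem_szE {P : Finset Pt} {M : Finset (ℝ × ℝ)} {e : Ed} :
    e ∈ szE P M ↔ ∃ l ∈ M, Seg P l e := by
  classical
  unfold szE
  rw [Finset.mem_filter, Finset.mem_product]
  exact ⟨fun h => h.2, fun h => ⟨by obtain ⟨l, _, h⟩ := h; exact ⟨h.left, h.right⟩, h⟩⟩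

lemma szE_good {P : Finset Pt} (hinj : ∀ u ∈ P, ∀ v ∈ P, u.1 = v.1 → u = v)
    (M : Finset (ℝ × ℝ)) : Good P (szE P M) := by
  refine ⟨hinj, ?_, ?_, ?_, ?_⟩
  · intro e he; obtain ⟨l, _, h⟩ := mem_szE.1 he; exact h.left
  · intro e he; obtain ⟨l, _, h⟩ := mem_szE.1 he; exact h.right
  · intro e he; obtain ⟨l, _, h⟩ := mem_szE.1 he; exact h.lt
  · intro e he v hv h1 h2 h3
    obtain ⟨l, _, h⟩ := mem_szE.1 he
    rw [h.ht] at h3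
    exact h.consec v hv h3 h1 h2

lemma szE_crs {P : Finset Pt} (hinj : ∀ u ∈ P, ∀ v ∈ P, u.1 = v.1 → u = v)
    (M : Finset (ℝ × ℝ)) : (crs (szE P M)).card ≤ M.card ^ 2 := by
  classical
  have hch : ∀ e : Ed, ∃ l : ℝ × ℝ, e ∈ szE P M → l ∈ M ∧ Seg P l e := by
    intro e
    by_cases h : e ∈ szE P M
    · obtain ⟨w, hw⟩ := mem_szE.1 h
      exact ⟨w, fun _ => hw⟩
    · exact ⟨0, fun h' => absurd h' h⟩
  choose φ hφ using hch
  rw [pow_two, ← Finset.card_product]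
  refine Finset.card_le_card_of_injOn (fun x => (φ x.1, φ x.2)) ?_ ?_
  · intro x hx
    have hx := Finset.mem_coe.1 hx
    simp only [crs, Finset.mem_filter, Finset.mem_product] at hx
    exact Finset.mem_coe.2 (Finset.mem_product.2 ⟨(hφ _ hx.1.1).1, (hφ _ hx.1.2).1⟩)
  · rintro ⟨e, f⟩ hx ⟨e', f'⟩ hy hxy
    have hx := Finset.mem_coe.1 hx
    have hy := Finset.mem_coe.1 hy
    simp only [crs, Finset.mem_filter, Finset.mem_product] at hx hy
    obtain ⟨⟨he, hf⟩, hne, t, t1, t2, t3, t4, t5⟩ := hx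
    obtain ⟨⟨he', hf'⟩, hne', s, s1, s2, s3, s4, s5⟩ := hy
    simp only [Prod.mk.injEq] at hxy
    have se := (hφ e he).2
    have sf := (hφ f hf).2
    have se' := (hφ e' he').2
    have sf' := (hφ f' hf').2
    rw [← hxy.1] at se'
    rw [← hxy.2] at sf'
    have hlne : φ e ≠ φ f := by
      intro h
      rw [h] at se
      exact hne (se.unique_edge hinj sf t1 t2 t3 t4)
    rw [se.ht, sf.ht] at t5
    rw [se'.ht, sf'.ht] at s5
    have hst : s = t := by
      by_contra hst
      apply hlne
      have : (φ e).1 = (φ f).1 := by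
        have h : ((φ e).1 - (φ f).1) * (s - t) = 0 := by linarith
        rcases mul_eq_zero.1 h with h | h
        · linarith
        · exact absurd (by linarith) hst
      refine Prod.ext this ?_
      rw [this] at t5
      linarith
    subst hst
    rw [se.unique_edge hinj se' t1 t2 s1 s2, sf.unique_edge hinj sf' t3 t4 s3 s4]

open Classical in
noncomputable def inc (P : Finset Pt) (M : Finset (ℝ × ℝ)) : Finset (Pt × (ℝ × ℝ)) :=
  (P ×ˢ M).filter (fun x => On x.1 x.2)

lemma inc_le {P : Finset Pt} (hinj : ∀ u ∈ P, ∀ v ∈ P, u.1 = v.1 → u = v)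
    (M : Finset (ℝ × ℝ)) : (inc P M).card ≤ (szE P M).card + M.card := by
  classical
  have memI : ∀ x, x ∈ inc P M ↔ (x.1 ∈ P ∧ x.2 ∈ M) ∧ On x.1 x.2 := by
    intro x; unfold inc; rw [Finset.mem_filter, Finset.mem_product]
  rw [← Finset.card_filter_add_card_filter_not
    (fun x : Pt × (ℝ × ℝ) => ∃ r ∈ P, On r x.2 ∧ x.1.1 < r.1)]
  apply add_le_add
  · have hch : ∀ x : Pt × (ℝ × ℝ), ∃ r : Pt, x ∈ inc P M → (∃ r ∈ P, On r x.2 ∧ x.1.1 < r.1) →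
        Seg P x.2 (x.1, r) := by
      intro x
      by_cases hx : x ∈ inc P M
      swap
      · exact ⟨0, fun h => absurd h hx⟩
      by_cases h : ∃ r ∈ P, On r x.2 ∧ x.1.1 < r.1
      swap
      · exact ⟨0, fun _ h' => absurd h' h⟩
      obtain ⟨r, hr, hmin⟩ := (P.filter (fun r => On r x.2 ∧ x.1.1 < r.1)).exists_min_image
        (fun r => r.1) (by obtain ⟨r, hr, h⟩ := h; exact ⟨r, Finset.mem_filter.2 ⟨hr, h⟩⟩)
      rw [Finset.mem_filter] at hr
      rw [memI] at hx
      refine ⟨r, fun _ _ => ⟨hx.1.1, hr.1, hr.2.2, hx.2, hr.2.1, ?_⟩⟩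
      intro q hq hqo h1 h2
      have := hmin q (Finset.mem_filter.2 ⟨hq, hqo, h1⟩)
      exact absurd h2 (not_lt.2 this)
    choose φ hφ using hch
    refine Finset.card_le_card_of_injOn (fun x => (x.1, φ x)) ?_ ?_
    · intro x hx
      obtain ⟨h1, h2⟩ := Finset.mem_filter.1 hx
      exact mem_szE.2 ⟨x.2, ((memI x).1 h1).1.2, hφ x h1 h2⟩
    · intro x hx y hy hxy
      obtain ⟨h1, h2⟩ := Finset.mem_filter.1 hx
      obtain ⟨h3, h4⟩ := Finset.mem_filter.1 hy
      have a := hφ x h1 h2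
      have b := hφ y h3 h4
      simp only at hxy
      rw [← hxy] at b
      exact Prod.ext (Prod.ext_iff.1 hxy).1 (a.unique_line b)
  · refine Finset.card_le_card_of_injOn (fun x => x.2) ?_ ?_
    · intro x hx
      obtain ⟨h1, h2⟩ := Finset.mem_filter.1 hx
      exact ((memI x).1 h1).1.2
    · intro x hx y hy hxy
      obtain ⟨h1, h2⟩ := Finset.mem_filter.1 hx
      obtain ⟨h3, h4⟩ := Finset.mem_filter.1 hy
      simp only at hxy
      rw [memI] at h1 h3
      refine Prod.ext (hinj _ h1.1.1 _ h3.1.1 ?_) hxy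
      push Not at h2 h4
      exact le_antisymm (h4 _ h1.1.1 (hxy ▸ h1.2)) (h2 _ h3.1.1 (hxy ▸ h3.2))

lemma main_bound {P : Finset Pt} (hinj : ∀ u ∈ P, ∀ v ∈ P, u.1 = v.1 → u = v)
    (M : Finset (ℝ × ℝ)) : ((inc P M).card : ℝ) ≤
      5 * ((P.card : ℝ) ^ ((2 : ℝ)/3) * (M.card : ℝ) ^ ((2 : ℝ)/3)) + 6 * P.card + M.card := by
  have h1 : ((inc P M).card : ℝ) ≤ (szE P M).card + M.card := by exact_mod_cast inc_le hinj M
  have hcr : ((crs (szE P M)).card : ℝ) ≤ (M.card : ℝ) ^ 2 := by exact_mod_cast szE_crs hinj M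
  have hp := fun (p : ℝ) h0 h1 => crossing_p (szE_good hinj M) (p := p) h0 h1
  set e : ℝ := ((szE P M).card : ℝ)
  set n : ℝ := (P.card : ℝ)
  set m : ℝ := (M.card : ℝ)
  set X : ℝ := ((crs (szE P M)).card : ℝ)
  have hn : 0 ≤ n := Nat.cast_nonneg _
  have hm : 0 ≤ m := Nat.cast_nonneg _
  have he : 0 ≤ e := Nat.cast_nonneg _
  set q : ℝ := n ^ ((2 : ℝ)/3) * m ^ ((2 : ℝ)/3) with hq
  have hq0 : 0 ≤ q := by positivity
  have hq3 : q ^ 3 = n ^ 2 * m ^ 2 := by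
    rw [hq, mul_pow, ← Real.rpow_natCast, ← Real.rpow_natCast, ← Real.rpow_mul hn,
      ← Real.rpow_mul hm]
    norm_num
  suffices e ≤ 5 * q + 6 * n by linarith
  by_cases hc : e ≤ 6 * n
  · linarith
  push Not at hc
  have he0 : 0 < e := by linarith
  have h3 : e ^ 3 ≤ 72 * (n ^ 2 * m ^ 2) := by
    have hpe := hp (6 * n / e) (by positivity) (by rw [div_le_one he0]; linarith)
    rcases hn.eq_or_lt with h0 | hnpos
    · exfalso
      have hP : P = ∅ := Finset.card_eq_zero.1 (Nat.cast_eq_zero.1 (show (P.card : ℝ) = 0 from h0.symm))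
      have : (szE P M).card = 0 := by
        rw [Finset.card_eq_zero]
        simp [szE, hP]
      have : ((szE P M).card : ℝ) = 0 := Nat.cast_eq_zero.2 this
      have : e = 0 := this
      linarith
    have hX : (6 * n / e) ^ 4 * X ≤ (6 * n / e) ^ 4 * m ^ 2 := by gcongr
    have h6 : (6 * n / e) ^ 2 * e ≤ 3 * (6 * n / e * n) + (6 * n / e) ^ 4 * m ^ 2 := by linarith
    have h7 : e ^ 4 * ((6 * n / e) ^ 2 * e) ≤
      e ^ 4 * (3 * (6 * n / e * n) + (6 * n / e) ^ 4 * m ^ 2) := by gcongr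
    have h8 : e ^ 4 * ((6 * n / e) ^ 2 * e) = n ^ 2 * (36 * e ^ 3) := by field_simp; ring
    have h9 : e ^ 4 * (3 * (6 * n / e * n) + (6 * n / e) ^ 4 * m ^ 2) =
        n ^ 2 * (18 * e ^ 3 + 1296 * n ^ 2 * m ^ 2) := by field_simp; ring
    rw [h8, h9] at h7
    have := le_of_mul_le_mul_left h7 (by positivity)
    linarith
  have h4 : e ^ 3 ≤ (5 * q) ^ 3 := by
    rw [mul_pow, hq3]
    nlinarith [mul_nonneg (sq_nonneg n) (sq_nonneg m)]
  have := le_of_pow_le_pow_left₀ (by norm_num) (by positivity) h4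
  linarith

/-- A shear making the first coordinates distinct. -/
lemma exists_shear (P : Finset Pt) : ∃ c : ℝ, ∀ u ∈ P, ∀ v ∈ P,
    u.1 + c * u.2 = v.1 + c * v.2 → u = v := by
  classical
  obtain ⟨c, hc⟩ := Infinite.exists_notMem_finset
    ((P ×ˢ P).image (fun x => (x.2.1 - x.1.1) / (x.1.2 - x.2.2)))
  refine ⟨c, fun u hu v hv h => ?_⟩
  by_cases h2 : u.2 = v.2
  · rw [h2] at h
    exact Prod.ext (by linarith) h2
  · exfalso
    apply hc
    rw [Finset.mem_image]
    refine ⟨(u, v), Finset.mem_product.2 ⟨hu, hv⟩, ?_⟩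
    have : u.2 - v.2 ≠ 0 := sub_ne_zero.2 h2
    simp only
    rw [div_eq_iff this]
    linarith

def shear (c : ℝ) (p : Pt) : Pt := (p.1 + c * p.2, p.2)

lemma shear_inj (c : ℝ) : Function.Injective (shear c) := by
  intro p q h
  simp only [shear, Prod.mk.injEq] at h
  obtain ⟨h1, h2⟩ := h
  rw [h2] at h1
  exact Prod.ext (by linarith) h2

/-- A line with two distinct points is determined by them. -/
lemma line_points {l : AffineSubspace ℝ Pt} (h : Module.finrank ℝ l.direction = 1) {p q : Pt}
    (hp : p ∈ l) (hq : q ∈ l) (hne : p ≠ q) (r : Pt) :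
    r ∈ l ↔ ∃ t : ℝ, r = t • (q - p) + p := by
  have hv : q - p ∈ l.direction := l.vsub_mem_direction hq hp
  have hv0 : (⟨q - p, hv⟩ : l.direction) ≠ 0 := by
    intro h
    exact hne (sub_eq_zero.1 (congrArg Subtype.val h)).symm
  constructor
  · intro hr
    obtain ⟨t, ht⟩ := (finrank_eq_one_iff_of_nonzero' _ hv0).1 h
      ⟨r - p, l.vsub_mem_direction hr hp⟩
    refine ⟨t, ?_⟩
    have := congrArg Subtype.val ht
    simp only [Submodule.coe_smul] at this
    rw [this]
    simp
  · rintro ⟨t, rfl⟩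
    exact AffineSubspace.vadd_mem_of_mem_direction (l.direction.smul_mem t hv) hp

end ST

open Classical in
/-- Szemerédi–Trotter theorem: incidences between points and lines in ℝ². -/
theorem szemeredi_trotter :
    ∃ C : ℝ, 0 < C ∧
      ∀ (P : Finset (ℝ × ℝ)) (L : Finset (AffineSubspace ℝ (ℝ × ℝ))),
        (∀ l ∈ L, Module.finrank ℝ l.direction = 1) →
        (((P ×ˢ L).filter (fun pl => pl.1 ∈ pl.2)).card : ℝ) ≤
          C * ((P.card : ℝ) ^ ((2 : ℝ)/3) * (L.card : ℝ) ^ ((2 : ℝ)/3)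
              + P.card + L.card) := by
  refine ⟨6, by norm_num, ?_⟩
  intro P L hL
  obtain ⟨c, hc⟩ := ST.exists_shear P
  -- rich lines: at least two points of `P`
  set Rich : AffineSubspace ℝ (ℝ × ℝ) → Prop :=
    fun l => ∃ p ∈ P, ∃ q ∈ P, p ≠ q ∧ p ∈ l ∧ q ∈ l with hRich
  -- equation of the sheared line
  have hch : ∀ l : AffineSubspace ℝ (ℝ × ℝ), ∃ m : ℝ × ℝ, l ∈ L → Rich l →
      ∀ r : ℝ × ℝ, r ∈ l ↔ ST.On (ST.shear c r) m := by
    intro l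
    by_cases hl : l ∈ L
    swap
    · exact ⟨0, fun h => absurd h hl⟩
    by_cases hr : Rich l
    swap
    · exact ⟨0, fun _ h => absurd h hr⟩
    obtain ⟨p, hp, q, hq, hne, hpl, hql⟩ := hr
    have hd : (q.1 + c * q.2) - (p.1 + c * p.2) ≠ 0 := by
      intro h
      exact hne (hc p hp q hq (by linarith))
    set d := (q.1 + c * q.2) - (p.1 + c * p.2) with hdd
    refine ⟨((q.2 - p.2) / d, p.2 - (q.2 - p.2) / d * (p.1 + c * p.2)), fun _ _ r => ?_⟩
    rw [ST.line_points (hL l hl) hpl hql hne]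
    unfold ST.On ST.shear
    simp only
    constructor
    · rintro ⟨t, rfl⟩
      simp only [Prod.fst_add, Prod.snd_add, Prod.smul_fst, Prod.smul_snd, Prod.fst_sub,
        Prod.snd_sub, smul_eq_mul]
      field_simp
      rw [hdd]
      ring
    · intro h
      refine ⟨((r.1 + c * r.2) - (p.1 + c * p.2)) / d, ?_⟩
      have h2 : r.2 = ((r.1 + c * r.2) - (p.1 + c * p.2)) / d * (q.2 - p.2) + p.2 := by
        calc r.2 = _ := h
          _ = _ := by field_simp; ring
      have h1 : r.1 + c * r.2 = ((r.1 + c * r.2) - (p.1 + c * p.2)) / d * d +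
          (p.1 + c * p.2) := by field_simp; ring
      set t := ((r.1 + c * r.2) - (p.1 + c * p.2)) / d
      refine Prod.ext ?_ ?_
      · simp only [Prod.fst_add, Prod.smul_fst, Prod.fst_sub, smul_eq_mul]
        rw [hdd] at h1
        linear_combination h1 - c * h2
      · simp only [Prod.snd_add, Prod.smul_snd, Prod.snd_sub, smul_eq_mul]
        exact h2
  choose φ hφ using hch
  set P' := P.image (ST.shear c) with hP'
  set M := (L.filter Rich).image φ with hM
  have hinj : ∀ u ∈ P', ∀ v ∈ P', u.1 = v.1 → u = v := by
    intro u hu v hv h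
    obtain ⟨a, ha, rfl⟩ := Finset.mem_image.1 hu
    obtain ⟨b, hb, rfl⟩ := Finset.mem_image.1 hv
    rw [hc a ha b hb h]
  have hmain := ST.main_bound hinj M
  have cP : P'.card = P.card := Finset.card_image_of_injective _ (ST.shear_inj c)
  have cM : M.card ≤ L.card := Finset.card_image_le.trans (Finset.card_filter_le _ _)
  have hI : ((P ×ˢ L).filter (fun pl => pl.1 ∈ pl.2)).card ≤ (ST.inc P' M).card + L.card := by
    rw [← Finset.card_filter_add_card_filter_not
      (fun x : (ℝ × ℝ) × AffineSubspace ℝ (ℝ × ℝ) => Rich x.2)]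
    apply add_le_add
    · refine Finset.card_le_card_of_injOn (fun x => (ST.shear c x.1, φ x.2)) ?_ ?_
      · intro x hx
        have hx := Finset.mem_coe.1 hx
        simp only [Finset.mem_filter, Finset.mem_product] at hx
        obtain ⟨⟨⟨h1, h2⟩, h3⟩, h4⟩ := hx
        rw [Finset.mem_coe]
        unfold ST.inc
        rw [Finset.mem_filter, Finset.mem_product]
        exact ⟨⟨Finset.mem_image_of_mem _ h1,
          Finset.mem_image_of_mem _ (Finset.mem_filter.2 ⟨h2, h4⟩)⟩, (hφ _ h2 h4 _).1 h3⟩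
      · intro x hx y hy hxy
        have hx := Finset.mem_coe.1 hx
        have hy := Finset.mem_coe.1 hy
        simp only [Finset.mem_filter, Finset.mem_product] at hx hy
        simp only [Prod.mk.injEq] at hxy
        refine Prod.ext (ST.shear_inj c hxy.1) ?_
        ext r
        rw [hφ _ hx.1.1.2 hx.2, hφ _ hy.1.1.2 hy.2, hxy.2]
    · refine Finset.card_le_card_of_injOn (fun x => x.2) ?_ ?_
      · intro x hx
        have hx := Finset.mem_coe.1 hx
        simp only [Finset.mem_filter, Finset.mem_product] at hx
        exact hx.1.1.2
      · intro x hx y hy hxy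
        have hx := Finset.mem_coe.1 hx
        have hy := Finset.mem_coe.1 hy
        simp only [Finset.mem_filter, Finset.mem_product] at hx hy
        simp only at hxy
        refine Prod.ext ?_ hxy
        by_contra hne
        exact hx.2 ⟨x.1, hx.1.1.1, y.1, hy.1.1.1, hne, hx.1.2, hxy ▸ hy.1.2⟩
  have hI' : (((P ×ˢ L).filter (fun pl => pl.1 ∈ pl.2)).card : ℝ) ≤
      (ST.inc P' M).card + L.card := by exact_mod_cast hI
  have cM' : (M.card : ℝ) ≤ L.card := by exact_mod_cast cM
  rw [cP] at hmain
  have hpow : (P.card : ℝ) ^ ((2 : ℝ)/3) * (M.card : ℝ) ^ ((2 : ℝ)/3) ≤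
      (P.card : ℝ) ^ ((2 : ℝ)/3) * (L.card : ℝ) ^ ((2 : ℝ)/3) := by gcongr
  have hnn : 0 ≤ (P.card : ℝ) ^ ((2 : ℝ)/3) * (L.card : ℝ) ^ ((2 : ℝ)/3) := by positivity
  have : (0 : ℝ) ≤ L.card := Nat.cast_nonneg _
  linarith
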